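/- arXiv:2605.00075 — 3 statements merged into one kernel-verified Lean document; each statement's English description precedes it below -/
import Mathlib

section
/- Let H be a complex Hilbert space, let A and N be von Neumann algebras on H, and let (B_i)_{i ∈ ι} be a family of von Neumann algebras on H. Assume (microcausality) that every B_i is contained in the commutant A', and (additivity) that N is generated by the family (B_i). Then the following are equivalent: (i) A' = N; (ii) the underlying set of A equals ⋂_{i ∈ ι} (B_i)'; (iii) for every von Neumann algebra M on H with A ⊆ M, if every finite family (v_k) of elements of M with ∑_k v_k* v_k = 1 satisfies ∑_k v_k* b v_k = b for every i ∈ ι and every b ∈ B_i, then M = A (CP-operational maximality with respect to finitely implemented normal unital completely positive maps). -/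
/-- `N` is the von Neumann algebra generated by the family `B`. -/
def VonNeumannAlgebra.IsGeneratedBy {H : Type*} [NormedAddCommGroup H]
    [InnerProductSpace ℂ H] [CompleteSpace H] (N : VonNeumannAlgebra H)
    {ι : Type*} (B : ι → VonNeumannAlgebra H) : Prop :=
  (∀ i, B i ≤ N) ∧ ∀ M : VonNeumannAlgebra H, (∀ i, B i ≤ M) → N ≤ M

namespace VonNeumannAlgebra

variable {H : Type*} [NormedAddCommGroup H] [InnerProductSpace ℂ H] [CompleteSpace H]

theorem le_commutant_comm {S T : VonNeumannAlgebra H} : S ≤ T.commutant ↔ T ≤ S.commutant := by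
  simp only [SetLike.le_def, mem_commutant_iff]
  exact ⟨fun h t ht s hs => (h hs t ht).symm, fun h s hs t ht => (h ht s hs).symm⟩

theorem isClosed (M : VonNeumannAlgebra H) : IsClosed (M : Set (H →L[ℂ] H)) := by
  rw [← centralizer_centralizer M]
  exact Set.isClosed_centralizer _

/-- An operator commuting with all unitaries of a von Neumann algebra lies in its commutant. -/
theorem mem_commutant_of_commute_unitary {M : VonNeumannAlgebra H} {b : H →L[ℂ] H}
    (h : ∀ u ∈ M, u ∈ unitary (H →L[ℂ] H) → u * b = b * u) : b ∈ M.commutant := by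
  rw [mem_commutant_iff]
  intro x hx
  have : IsClosed (M.toStarSubalgebra : Set (H →L[ℂ] H)) := M.isClosed
  suffices ∀ y : M.toStarSubalgebra, (y : H →L[ℂ] H) * b = b * y from this ⟨x, hx⟩
  intro y
  have hspan : y ∈ Submodule.span ℂ (unitary M.toStarSubalgebra : Set M.toStarSubalgebra) := by
    rw [CStarAlgebra.span_unitary]
    trivial
  induction hspan using Submodule.span_induction with
  | mem u hu => exact h u u.2 ⟨congrArg Subtype.val hu.1, congrArg Subtype.val hu.2⟩
  | zero => simp
  | add y z _ _ hy hz => simpa [add_mul, mul_add] using congrArg₂ (· + ·) hy hz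
  | smul c y _ hy => simpa using congrArg (c • ·) hy

/-- The von Neumann algebra of operators commuting with `x` and `star x`. -/
noncomputable def commutantSingleton (x : H →L[ℂ] H) : VonNeumannAlgebra H where
  toStarSubalgebra := StarSubalgebra.centralizer ℂ {x}
  centralizer_centralizer' := by simp

theorem mem_commutantSingleton_iff {x z : H →L[ℂ] H} :
    z ∈ commutantSingleton x ↔ x * z = z * x ∧ star x * z = z * star x := by
  change z ∈ StarSubalgebra.centralizer ℂ {x} ↔ _
  simp [StarSubalgebra.mem_centralizer_iff]

theorem IsGeneratedBy.le_iff {N M : VonNeumannAlgebra H} {ι : Type*}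
    {B : ι → VonNeumannAlgebra H} (hgen : N.IsGeneratedBy B) : N ≤ M ↔ ∀ i, B i ≤ M :=
  ⟨fun h i => (hgen.1 i).trans h, hgen.2 M⟩

theorem IsGeneratedBy.coe_commutant {N : VonNeumannAlgebra H} {ι : Type*}
    {B : ι → VonNeumannAlgebra H} (hgen : N.IsGeneratedBy B) :
    (N.commutant : Set (H →L[ℂ] H)) = ⋂ i, ((B i).commutant : Set (H →L[ℂ] H)) := by
  ext x
  simp only [Set.mem_iInter, SetLike.mem_coe]
  refine ⟨fun hx i => ?_, fun hx => ?_⟩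
  · rw [mem_commutant_iff] at hx ⊢
    exact fun b hb => hx b (hgen.1 i hb)
  · have hN : N ≤ commutantSingleton x := hgen.2 _ fun i b hb =>
      mem_commutantSingleton_iff.2 ⟨(mem_commutant_iff.1 (hx i) b hb).symm,
        (mem_commutant_iff.1 (star_mem (hx i)) b hb).symm⟩
    exact mem_commutant_iff.2 fun n hn => (mem_commutantSingleton_iff.1 (hN hn)).1.symm

/-- All finitely implemented unital completely positive maps in `M` fix `b` if and only if
`b` commutes with `M`. -/
theorem forall_kraus_fixed_iff_mem_commutant {M : VonNeumannAlgebra H} {b : H →L[ℂ] H} :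
    (∀ n : ℕ, ∀ v : Fin n → (H →L[ℂ] H), (∀ k, v k ∈ M) →
      (∑ k, star (v k) * v k = 1) → ∑ k, star (v k) * b * v k = b) ↔ b ∈ M.commutant := by
  refine ⟨fun h => mem_commutant_of_commute_unitary fun u hu huu => ?_,
    fun hb n v hv hsum => ?_⟩
  · have hfix : star u * b * u = b := by
      simpa using h 1 (fun _ => u) (fun _ => hu) (by simpa using huu.1)
    calc u * b = u * (star u * b * u) := by rw [hfix]
      _ = u * star u * (b * u) := by simp only [mul_assoc]
      _ = b * u := by rw [huu.2, one_mul]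
  · have hcomm (k) : star (v k) * b * v k = b * (star (v k) * v k) := by
      rw [mem_commutant_iff.1 hb _ (star_mem (hv k)), mul_assoc]
    simp only [hcomm, ← Finset.mul_sum, hsum, mul_one]

end VonNeumannAlgebra

/-- **CP-operational maximality ⇔ essential duality** (finitely implemented channels). -/
theorem cp_operational_maximality_iff_essential_duality {H : Type*} [NormedAddCommGroup H]
    [InnerProductSpace ℂ H] [CompleteSpace H]
    (A N : VonNeumannAlgebra H) {ι : Type*} (B : ι → VonNeumannAlgebra H)
    (hmicro : ∀ i, B i ≤ A.commutant)
    (hgen : N.IsGeneratedBy B) :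
    List.TFAE
      [ A.commutant = N,
        (A : Set (H →L[ℂ] H)) = ⋂ i, ((B i).commutant : Set (H →L[ℂ] H)),
        ∀ M : VonNeumannAlgebra H, A ≤ M →
          (∀ n : ℕ, ∀ v : Fin n → (H →L[ℂ] H), (∀ k, v k ∈ M) →
            (∑ k, star (v k) * v k = 1) →
            ∀ i, ∀ b ∈ B i, ∑ k, star (v k) * b * v k = b) →
          M = A ] := by
  rw [← hgen.coe_commutant]
  tfae_have 1 ↔ 2 := by
    rw [SetLike.coe_set_eq]
    exact ⟨fun h => by rw [← h, VonNeumannAlgebra.commutant_commutant],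
      fun h => by rw [h, VonNeumannAlgebra.commutant_commutant]⟩
  tfae_have 2 ↔ 3 := by
    rw [SetLike.coe_set_eq]
    have hfix (M : VonNeumannAlgebra H) :
        (∀ n : ℕ, ∀ v : Fin n → (H →L[ℂ] H), (∀ k, v k ∈ M) →
          (∑ k, star (v k) * v k = 1) →
          ∀ i, ∀ b ∈ B i, ∑ k, star (v k) * b * v k = b) ↔ M ≤ N.commutant := by
      rw [VonNeumannAlgebra.le_commutant_comm, hgen.le_iff]
      simp only [SetLike.le_def, ← VonNeumannAlgebra.forall_kraus_fixed_iff_mem_commutant]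
      exact ⟨fun h i b hb n v hv hsum => h n v hv hsum i b hb,
        fun h n v hv hsum i b hb => h i hb n v hv hsum⟩
    simp only [hfix]
    refine ⟨fun h M hAM hMN => le_antisymm (h ▸ hMN) hAM, fun h => (h _ ?_ le_rfl).symm⟩
    exact VonNeumannAlgebra.le_commutant_comm.1 (hgen.le_iff.2 hmicro)
  tfae_finish
end

section
/- In Minkowski space ℝ^{1,3}, let O = I⁺(a) ∩ I⁻(b) and V = I⁺(c) ∩ I⁻(d) be nonempty open double cones such that the closure of V is contained in the causal complement O' of O. Then there exists a wedge W (a Poincaré transform of the standard right wedge W_R = {x : x₁ > |x₀|}) such that O ⊆ W and the closure of V is contained in the causal complement W' of W. -/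
namespace Minkowski

/-- Minkowski space `ℝ^{1,3}` as functions `Fin 4 → ℝ`. -/
abbrev Spacetime : Type := Fin 4 → ℝ

/-- The Minkowski bilinear form `η(x,y) = x₀y₀ − x₁y₁ − x₂y₂ − x₃y₃`. -/
def eta (x y : Spacetime) : ℝ := x 0 * y 0 - x 1 * y 1 - x 2 * y 2 - x 3 * y 3

/-- The open forward light cone at `a`. -/
def forwardCone (a : Spacetime) : Set Spacetime :=
  {x | eta (x - a) (x - a) > 0 ∧ x 0 > a 0}

/-- The open backward light cone at `b`. -/
def backwardCone (b : Spacetime) : Set Spacetime :=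
  {x | eta (x - b) (x - b) > 0 ∧ x 0 < b 0}

/-- The causal (spacelike) complement of a set `S`. -/
def causalComplement (S : Set Spacetime) : Set Spacetime :=
  {y | ∀ x ∈ S, eta (x - y) (x - y) < 0}

/-- The standard right wedge `W_R = {x : x₁ > |x₀|}`. -/
def standardWedge : Set Spacetime := {x | |x 0| < x 1}

/-- A Poincaré transformation: an affine bijection of Minkowski space whose linear part
preserves the Minkowski form. -/
def IsPoincare (g : Spacetime → Spacetime) : Prop :=
  Function.Bijective g ∧
  ∃ L : Spacetime →ₗ[ℝ] Spacetime,
    (∀ x y, eta (L x) (L y) = eta x y) ∧ ∀ x, g x = L x + g 0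

/-- A wedge is a Poincaré transform of the standard right wedge. -/
def IsWedge (W : Set Spacetime) : Prop :=
  ∃ g : Spacetime → Spacetime, IsPoincare g ∧ W = g '' standardWedge

lemma eta_comm (x y : Spacetime) : eta x y = eta y x := by
  simp only [eta]; ring

lemma eta_add_left (x y z : Spacetime) : eta (x + y) z = eta x z + eta y z := by
  simp only [eta, Pi.add_apply]; ring

lemma eta_sub_left (x y z : Spacetime) : eta (x - y) z = eta x z - eta y z := by
  simp only [eta, Pi.sub_apply]; ring

lemma eta_smul_left (t : ℝ) (x y : Spacetime) : eta (t • x) y = t * eta x y := by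
  simp only [eta, Pi.smul_apply, smul_eq_mul]; ring

lemma eta_add_right (x y z : Spacetime) : eta x (y + z) = eta x y + eta x z := by
  simp only [eta, Pi.add_apply]; ring

lemma eta_sub_right (x y z : Spacetime) : eta x (y - z) = eta x y - eta x z := by
  simp only [eta, Pi.sub_apply]; ring

lemma eta_smul_right (t : ℝ) (x y : Spacetime) : eta x (t • y) = t * eta x y := by
  simp only [eta, Pi.smul_apply, smul_eq_mul]; ring

lemma continuous_eta_right (k : Spacetime) : Continuous fun x => eta x k := by
  unfold eta; fun_prop

/-- The `η`-orthogonal reflection along `v`. -/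
noncomputable def reflection (v : Spacetime) : Spacetime →ₗ[ℝ] Spacetime where
  toFun x := x - (2 * eta x v / eta v v) • v
  map_add' x y := by
    rw [eta_add_left, mul_add, add_div, add_smul]; abel
  map_smul' t x := by
    rw [eta_smul_left, RingHom.id_apply, smul_sub, smul_smul]
    congr 2; ring

lemma reflection_apply (v x : Spacetime) :
    reflection v x = x - (2 * eta x v / eta v v) • v := rfl

lemma eta_reflection {v : Spacetime} (hv : eta v v ≠ 0) (x y : Spacetime) :
    eta (reflection v x) (reflection v y) = eta x y := by
  simp only [reflection_apply, eta_sub_left, eta_sub_right, eta_smul_left, eta_smul_right,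
    eta_comm v y]
  field_simp
  ring

lemma reflection_involutive {v : Spacetime} (hv : eta v v ≠ 0) :
    Function.Involutive (reflection v) := by
  intro x
  simp only [reflection_apply, eta_sub_left, eta_smul_left]
  rw [sub_sub, ← add_smul]
  have : 2 * eta x v / eta v v +
      2 * (eta x v - 2 * eta x v / eta v v * eta v v) / eta v v = 0 := by
    field_simp; ring
  rw [this, zero_smul, sub_zero]

/-- Two vectors of equal square whose difference is zero or non-null are exchanged by a Lorentz
transformation that fixes the orthogonal complement of the difference. -/
lemma exists_lorentz_map_eq {u v : Spacetime} (huv : eta u u = eta v v)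
    (h : eta (u - v) (u - v) = 0 → u = v) :
    ∃ L : Spacetime ≃ₗ[ℝ] Spacetime, (∀ x y, eta (L x) (L y) = eta x y) ∧ L u = v ∧ L v = u ∧
      ∀ x, eta x (u - v) = 0 → L x = x := by
  by_cases h0 : eta (u - v) (u - v) = 0
  · obtain rfl := h h0
    exact ⟨LinearEquiv.refl ℝ _, by simp⟩
  have hu : reflection (u - v) u = v := by
    have : 2 * eta u (u - v) = eta (u - v) (u - v) := by
      simp only [eta_sub_left, eta_sub_right, eta_comm v u]; linarith
    rw [reflection_apply, this, div_self h0, one_smul, sub_sub_cancel]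
  refine ⟨LinearEquiv.ofInvolutive _ (reflection_involutive h0), eta_reflection h0, hu, ?_, ?_⟩
  · change reflection (u - v) v = u
    simpa [hu] using reflection_involutive h0 u
  · intro x hx
    change reflection (u - v) x = x
    simp [reflection_apply, hx]

lemma eq_of_time_eq_of_eta_sub_eq_zero {x y : Spacetime} (h0 : x 0 = y 0)
    (h : eta (x - y) (x - y) = 0) : x = y := by
  simp only [eta, Pi.sub_apply] at h
  rw [h0] at h
  have h1 : x 1 - y 1 = 0 := by
    nlinarith [sq_nonneg (x 1 - y 1), sq_nonneg (x 2 - y 2), sq_nonneg (x 3 - y 3)]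
  have h2 : x 2 - y 2 = 0 := by
    nlinarith [sq_nonneg (x 1 - y 1), sq_nonneg (x 2 - y 2), sq_nonneg (x 3 - y 3)]
  have h3 : x 3 - y 3 = 0 := by
    nlinarith [sq_nonneg (x 1 - y 1), sq_nonneg (x 2 - y 2), sq_nonneg (x 3 - y 3)]
  ext i
  fin_cases i <;> simp <;> linarith

/-- A vector `k` is a normalized null vector if it is null with time component `1`. -/
def IsUnitNull (k : Spacetime) : Prop := k 0 = 1 ∧ eta k k = 0

lemma IsUnitNull.eta_pos {k l : Spacetime} (hk : IsUnitNull k) (hl : IsUnitNull l)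
    (hne : k ≠ l) : 0 < eta k l := by
  have h : eta (k - l) (k - l) = -2 * eta k l := by
    simp only [eta_sub_left, eta_sub_right, hk.2, hl.2, eta_comm l k]; ring
  have hle : eta (k - l) (k - l) ≤ 0 := by
    simp only [eta, Pi.sub_apply, hk.1, hl.1]
    nlinarith [sq_nonneg (k 1 - l 1), sq_nonneg (k 2 - l 2), sq_nonneg (k 3 - l 3)]
  have : eta (k - l) (k - l) ≠ 0 := fun h0 =>
    hne (eq_of_time_eq_of_eta_sub_eq_zero (hk.1.trans hl.1.symm) h0)
  have := lt_of_le_of_ne hle this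
  linarith

lemma eta_pos_of_timelike_of_causal {u k : Spacetime} (hu : 0 < eta u u) (hu0 : 0 < u 0)
    (hk : 0 ≤ eta k k) (hk0 : 0 < k 0) : 0 < eta u k := by
  simp only [eta] at *
  have hcs : (u 1 * k 1 + u 2 * k 2 + u 3 * k 3) ^ 2 ≤
      (u 1 ^ 2 + u 2 ^ 2 + u 3 ^ 2) * (k 1 ^ 2 + k 2 ^ 2 + k 3 ^ 2) := by
    nlinarith [sq_nonneg (u 1 * k 2 - u 2 * k 1), sq_nonneg (u 1 * k 3 - u 3 * k 1),
      sq_nonneg (u 2 * k 3 - u 3 * k 2)]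
  have hmul : (u 1 ^ 2 + u 2 ^ 2 + u 3 ^ 2) * (k 1 ^ 2 + k 2 ^ 2 + k 3 ^ 2) < u 0 ^ 2 * k 0 ^ 2 :=
    (mul_le_mul_of_nonneg_left (by linarith) (by positivity)).trans_lt
      (mul_lt_mul_of_pos_right (by linarith) (by positivity))
  have := (abs_lt.mp (abs_lt_of_sq_lt_sq (hcs.trans_lt (hmul.trans_eq (mul_pow _ _ 2).symm))
    (by positivity))).2
  linarith

lemma IsUnitNull.eta_timelike_pos {k u : Spacetime} (hk : IsUnitNull k) (hu : 0 < eta u u)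
    (hu0 : 0 < u 0) : 0 < eta u k :=
  eta_pos_of_timelike_of_causal hu hu0 hk.2.ge (by simp [hk.1])

lemma exists_isUnitNull_eta_nonpos {w : Spacetime} (hw : eta w w ≤ 0) :
    ∃ k, IsUnitNull k ∧ eta w k ≤ 0 := by
  simp only [eta] at hw
  set s := w 1 ^ 2 + w 2 ^ 2 + w 3 ^ 2 with hs
  have hs0 : 0 ≤ s := by positivity
  have hws : w 0 ^ 2 ≤ s := by linarith
  rcases hs0.eq_or_lt with h | h
  · have h1 : w 1 = 0 := by nlinarith [sq_nonneg (w 1), sq_nonneg (w 2), sq_nonneg (w 3)]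
    have h0 : w 0 = 0 := by nlinarith [sq_nonneg (w 0)]
    exact ⟨![1, 1, 0, 0], by simp [IsUnitNull, eta], by simp [eta, h0, h1]⟩
  · have hr : 0 < √s := Real.sqrt_pos.mpr h
    have hr2 : √s ^ 2 = s := Real.sq_sqrt hs0
    have hle : w 0 ≤ √s := Real.le_sqrt_of_sq_le hws
    refine ⟨![1, w 1 / √s, w 2 / √s, w 3 / √s], ⟨rfl, ?_⟩, ?_⟩
    · simp only [eta, Matrix.cons_val]
      field_simp
      linarith
    · have : w 1 * (w 1 / √s) + w 2 * (w 2 / √s) + w 3 * (w 3 / √s) = √s := by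
        field_simp
        linarith
      simp only [eta, Matrix.cons_val]
      linarith

/-- Any two distinct normalized null vectors are, up to a common scale, the images of the standard
null vectors `(1, 1, 0, 0)` and `(1, -1, 0, 0)` under a Lorentz transformation. -/
lemma exists_lorentz_null_coordinates {k l : Spacetime} (hk : IsUnitNull k) (hl : IsUnitNull l)
    (hne : k ≠ l) :
    ∃ (L : Spacetime ≃ₗ[ℝ] Spacetime) (r : ℝ), 0 < r ∧ (∀ x y, eta (L x) (L y) = eta x y) ∧
      ∀ x, x 0 - x 1 = r * eta (L x) k ∧ x 0 + x 1 = r * eta (L x) l := by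
  have hkl := hk.eta_pos hl hne
  obtain ⟨r, hr, hr2⟩ : ∃ r : ℝ, 0 < r ∧ r ^ 2 * (2 * eta k l) = 1 := by
    refine ⟨(√(2 * eta k l))⁻¹, by positivity, ?_⟩
    rw [inv_pow, Real.sq_sqrt (by positivity), inv_mul_cancel₀ (by positivity)]
  let E₀ : Spacetime := ![1, 0, 0, 0]
  let E₁ : Spacetime := ![0, 1, 0, 0]
  have hE₀ : ∀ x, eta x E₀ = x 0 := fun x => by simp [eta, E₀]
  have hE₁ : ∀ x, eta x E₁ = -x 1 := fun x => by simp [eta, E₁]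
  set e₀ := r • (k + l) with he₀
  set e₁ := r • (k - l) with he₁
  have h00 : eta e₀ e₀ = 1 := by
    simp only [he₀, eta_smul_left, eta_smul_right, eta_add_left, eta_add_right, hk.2, hl.2,
      eta_comm l k]
    linarith
  have h11 : eta e₁ e₁ = -1 := by
    simp only [he₁, eta_smul_left, eta_smul_right, eta_sub_left, eta_sub_right, hk.2, hl.2,
      eta_comm l k]
    linarith
  have h10 : eta e₁ e₀ = 0 := by
    simp only [he₀, he₁, eta_smul_left, eta_smul_right, eta_sub_left, eta_add_right, hk.2, hl.2,
      eta_comm l k]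
    ring
  have hEE : eta E₀ E₀ = 1 := by simp [hE₀, E₀]
  obtain ⟨A, hA, hA₀, hA₀', -⟩ := exists_lorentz_map_eq (u := E₀) (v := e₀)
    (by rw [h00, hEE]) (fun h => by
      refine eq_of_time_eq_of_eta_sub_eq_zero ?_ h
      rw [eta_sub_left, eta_sub_right, eta_sub_right, hEE, h00, eta_comm E₀ e₀, hE₀ e₀] at h
      change 1 = e₀ 0
      linarith)
  have hAe : (A e₁) 0 = 0 := by rw [← hE₀ (A e₁), ← hA₀', hA, h10]
  obtain ⟨B, hB, hB₁, -, hBfix⟩ := exists_lorentz_map_eq (u := E₁) (v := A e₁)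
    (by rw [hA, h11, hE₁]; simp [E₁])
    (fun h => eq_of_time_eq_of_eta_sub_eq_zero (by rw [hAe]; simp [E₁]) h)
  have hB₀ : B E₀ = E₀ := hBfix _ (by rw [eta_comm, hE₀]; simp [hAe, E₁])
  have hAA (x y : Spacetime) : eta (A.symm x) (A.symm y) = eta x y := by
    rw [← hA, A.apply_symm_apply, A.apply_symm_apply]
  have hL (x y : Spacetime) : eta (A.symm (B x)) (A.symm (B y)) = eta x y := by rw [hAA, hB]
  refine ⟨B.trans A.symm, 2 * r, by positivity, hL, fun x => ?_⟩
  have hL₀ : eta (A.symm (B x)) e₀ = x 0 := by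
    rw [← hE₀ x, ← hL x E₀, hB₀, ← hA₀', A.symm_apply_apply]
  have hL₁ : eta (A.symm (B x)) e₁ = -x 1 := by
    rw [← hE₁ x, ← hL x E₁, hB₁, A.symm_apply_apply]
  rw [LinearEquiv.trans_apply]
  simp only [he₀, he₁, eta_smul_right, eta_add_right, eta_sub_right] at hL₀ hL₁
  constructor <;> linarith

lemma isWedge_of_isUnitNull {k l : Spacetime} (hk : IsUnitNull k) (hl : IsUnitNull l)
    (hne : k ≠ l) (p : Spacetime) :
    IsWedge {x | eta (x - p) k < 0 ∧ 0 < eta (x - p) l} := by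
  obtain ⟨L, r, hr, hL, hcoord⟩ := exists_lorentz_null_coordinates hk hl hne
  have hmem (x : Spacetime) :
      x ∈ standardWedge ↔ eta (L x) k < 0 ∧ 0 < eta (L x) l := by
    obtain ⟨h1, h2⟩ := hcoord x
    rw [← mul_pos_iff_of_pos_left hr, ← h2, ← neg_pos, ← mul_pos_iff_of_pos_left hr, mul_neg,
      ← h1, standardWedge, Set.mem_ofPred_eq, abs_lt]
    constructor <;> rintro ⟨_, _⟩ <;> constructor <;> linarith
  refine ⟨fun x => L x + p, ⟨(Equiv.addRight p).bijective.comp L.bijective, L.toLinearMap, hL,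
    fun x => by simp⟩, ?_⟩
  ext x
  constructor
  · intro hx
    refine ⟨L.symm (x - p), (hmem _).2 (by simpa using hx), by simp⟩
  · rintro ⟨y, hy, rfl⟩
    simpa using (hmem y).1 hy

lemma eta_self_neg_of_isUnitNull {k l z : Spacetime} (hk : IsUnitNull k) (hl : IsUnitNull l)
    (hne : k ≠ l) (hzk : eta z k < 0) (hzl : 0 < eta z l) : eta z z < 0 := by
  obtain ⟨L, r, hr, hL, hcoord⟩ := exists_lorentz_null_coordinates hk hl hne
  obtain ⟨w, rfl⟩ := L.surjective z
  obtain ⟨h1, h2⟩ := hcoord w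
  rw [hL]
  have h3 : w 0 - w 1 < 0 := h1 ▸ mul_neg_of_pos_of_neg hr hzk
  have h4 : 0 < w 0 + w 1 := h2 ▸ mul_pos hr hzl
  simp only [eta]
  nlinarith [mul_pos (neg_pos.2 h3) h4, sq_nonneg (w 2), sq_nonneg (w 3)]

lemma eta_sub_tip_pos {a b x : Spacetime} (hx : x ∈ forwardCone a ∩ backwardCone b)
    {k : Spacetime} (hk : IsUnitNull k) : 0 < eta (x - a) k ∧ 0 < eta (b - x) k := by
  obtain ⟨⟨h1, h2⟩, h3, h4⟩ := hx
  refine ⟨hk.eta_timelike_pos h1 (sub_pos.2 h2), hk.eta_timelike_pos ?_ (sub_pos.2 h4)⟩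
  simp only [eta, Pi.sub_apply] at h3 ⊢
  linarith

/-- The tips of a nonempty double cone are timelike separated. -/
lemma tips_timelike {a b : Spacetime} (h : (forwardCone a ∩ backwardCone b).Nonempty) :
    0 < eta (b - a) (b - a) ∧ 0 < (b - a) 0 := by
  obtain ⟨x, ⟨h1, h2⟩, h3, h4⟩ := h
  have h5 : 0 < eta (b - x) (b - x) := by
    simp only [eta, Pi.sub_apply] at h3 ⊢; linarith
  have h6 := eta_pos_of_timelike_of_causal h1 (sub_pos.2 h2) h5.le (sub_pos.2 h4)
  refine ⟨?_, sub_pos.2 (h2.trans h4)⟩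
  rw [← sub_add_sub_cancel b x a, eta_add_left, eta_add_right, eta_add_right,
    eta_comm (b - x) (x - a)]
  linarith

lemma segment_mem {a b : Spacetime} (hab : 0 < eta (b - a) (b - a) ∧ 0 < (b - a) 0) {t : ℝ}
    (ht0 : 0 < t) (ht1 : t < 1) : a + t • (b - a) ∈ forwardCone a ∩ backwardCone b := by
  obtain ⟨h1, h2⟩ := hab
  have hb : a + t • (b - a) - b = (t - 1) • (b - a) := by
    rw [sub_smul, one_smul]; abel
  have hs : 0 < 1 - t := sub_pos.2 ht1
  refine ⟨⟨?_, ?_⟩, ?_, ?_⟩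
  · rw [add_sub_cancel_left, eta_smul_left, eta_smul_right]
    positivity
  · simp only [Pi.add_apply, Pi.smul_apply, smul_eq_mul]
    nlinarith [mul_pos ht0 h2]
  · rw [hb, eta_smul_left, eta_smul_right]
    nlinarith [mul_pos (mul_pos hs hs) h1]
  · have := congrFun hb 0
    simp only [Pi.sub_apply, Pi.smul_apply, smul_eq_mul] at this h2 ⊢
    nlinarith [mul_pos hs h2]

lemma eta_nonpos_of_forall_add_smul {w u : Spacetime}
    (h : ∀ t : ℝ, 0 < t → t < 1 → eta (w + t • u) (w + t • u) < 0) : eta w w ≤ 0 := by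
  have hc : Continuous fun t : ℝ => eta (w + t • u) (w + t • u) := by
    unfold eta; fun_prop
  have ht : Filter.Tendsto (fun t : ℝ => eta (w + t • u) (w + t • u))
      (nhdsWithin 0 (Set.Ioi 0)) (nhds (eta w w)) := by
    simpa using (hc.tendsto 0).mono_left nhdsWithin_le_nhds
  refine le_of_tendsto ht ?_
  filter_upwards [Ioo_mem_nhdsGT (zero_lt_one' ℝ)] with t ht
  exact (h t ht.1 ht.2).le

/-- **Wedge separation for double cones.** Strictly spacelike-separated nonempty open
double cones can be separated by opposite wedges. -/
theorem wedge_separation_for_double_cones (a b c d : Spacetime)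
    (O V : Set Spacetime)
    (hO : O = forwardCone a ∩ backwardCone b)
    (hV : V = forwardCone c ∩ backwardCone d)
    (hOne : O.Nonempty) (hVne : V.Nonempty)
    (hsep : closure V ⊆ causalComplement O) :
    ∃ W : Set Spacetime, IsWedge W ∧ O ⊆ W ∧ closure V ⊆ causalComplement W := by
  subst hO hV
  have hab := tips_timelike hOne
  have hcd := tips_timelike hVne
  have hspace {s t : ℝ} (hs0 : 0 < s) (hs1 : s < 1) (ht0 : 0 < t) (ht1 : t < 1) :=
    hsep (subset_closure (segment_mem hcd ht0 ht1)) _ (segment_mem hab hs0 hs1)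
  have hbc : eta (b - c) (b - c) ≤ 0 := by
    refine eta_nonpos_of_forall_add_smul (u := -((b - a) + (d - c))) fun t ht0 ht1 => ?_
    convert hspace (sub_pos.2 ht1) (sub_lt_self 1 ht0) ht0 ht1 using 2 <;> module
  have hda : eta (d - a) (d - a) ≤ 0 := by
    refine eta_nonpos_of_forall_add_smul (u := -((b - a) + (d - c))) fun t ht0 ht1 => ?_
    have h := hspace ht0 ht1 (sub_pos.2 ht1) (sub_lt_self 1 ht0)
    have hneg : ∀ z : Spacetime, eta (-z) (-z) = eta z z := fun z => by simp [eta]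
    rw [← hneg] at h
    convert h using 2 <;> module
  obtain ⟨k, hk, hbck⟩ := exists_isUnitNull_eta_nonpos hbc
  obtain ⟨l, hl, hdal⟩ := exists_isUnitNull_eta_nonpos hda
  have hne : k ≠ l := by
    rintro rfl
    have h1 := hk.eta_timelike_pos hab.1 hab.2
    have h2 := hk.eta_timelike_pos hcd.1 hcd.2
    simp only [eta_sub_left] at *
    linarith
  have hkl := hk.eta_pos hl hne
  obtain ⟨p, hpk, hpl⟩ : ∃ p, eta p k = eta b k ∧ eta p l = eta a l := by
    refine ⟨(eta a l / eta k l) • k + (eta b k / eta k l) • l, ?_, ?_⟩ <;>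
      simp only [eta_add_left, eta_smul_left, hk.2, hl.2, eta_comm l k] <;> field_simp <;> ring
  refine ⟨_, isWedge_of_isUnitNull hk hl hne p, fun x hx => ?_, fun y hy x hx => ?_⟩
  · have h1 := (eta_sub_tip_pos hx hk).2
    have h2 := (eta_sub_tip_pos hx hl).1
    simp only [Set.mem_ofPred_eq, eta_sub_left] at *
    constructor <;> linarith
  · have hclosed : IsClosed {y | eta c k ≤ eta y k ∧ eta y l ≤ eta d l} :=
      (isClosed_le continuous_const (continuous_eta_right k)).inter
        (isClosed_le (continuous_eta_right l) continuous_const)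
    have hy' : eta c k ≤ eta y k ∧ eta y l ≤ eta d l := by
      refine closure_minimal (fun z hz => ?_) hclosed hy
      have h1 := (eta_sub_tip_pos hz hk).1
      have h2 := (eta_sub_tip_pos hz hl).2
      simp only [Set.mem_ofPred_eq, eta_sub_left] at *
      constructor <;> linarith
    obtain ⟨hx1, hx2⟩ := hx
    refine eta_self_neg_of_isUnitNull hk hl hne ?_ ?_ <;> simp only [eta_sub_left] at * <;> linarith

end Minkowski
end

section
/- In Minkowski space ℝ^{1,3}, for every point x, the intersection of the closures of all wedges containing x equals the singleton {x}: ⋂ {closure(W) : W a wedge with x ∈ W} = {x}. In particular, for every y ≠ x there exists a wedge W with x ∈ W and y ∉ closure(W). -/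
namespace Minkowski

/-- The map permuting the coordinates by the transposition of `1` and `i` and multiplying
by `s`. -/
def scaledSwap (i : Fin 4) (s : ℝ) : Spacetime →ₗ[ℝ] Spacetime :=
  s • LinearMap.funLeft ℝ ℝ (Equiv.swap 1 i)

lemma scaledSwap_apply (i : Fin 4) (s : ℝ) (z : Spacetime) (j : Fin 4) :
    scaledSwap i s z j = s * z (Equiv.swap 1 i j) := rfl

lemma scaledSwap_involutive (i : Fin 4) {s : ℝ} (hs : s * s = 1) :
    Function.Involutive (scaledSwap i s) := by
  intro z
  ext j
  rw [scaledSwap_apply, scaledSwap_apply, Equiv.swap_apply_self, ← mul_assoc, hs, one_mul]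

lemma eta_scaledSwap {i : Fin 4} (hi : i ≠ 0) {s : ℝ} (hs : s * s = 1) (x y : Spacetime) :
    eta (scaledSwap i s x) (scaledSwap i s y) = eta x y := by
  have key (j : Fin 4) : scaledSwap i s x j * scaledSwap i s y j =
      x (Equiv.swap 1 i j) * y (Equiv.swap 1 i j) := by
    rw [scaledSwap_apply, scaledSwap_apply, mul_mul_mul_comm, hs, one_mul]
  simp only [eta, key]
  fin_cases i
  · exact absurd rfl hi
  · simp
  · simp [Equiv.swap_apply_def]
    ring
  · simp [Equiv.swap_apply_def]
    ring

lemma isPoincare_scaledSwap_add {i : Fin 4} (hi : i ≠ 0) {s : ℝ} (hs : s * s = 1)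
    (a : Spacetime) : IsPoincare fun z => scaledSwap i s z + a :=
  ⟨(Equiv.addRight a).bijective.comp (scaledSwap_involutive i hs).bijective,
    scaledSwap i s, eta_scaledSwap hi hs, fun z => by simp⟩

/-- The wedge with apex `a` opening in the direction of the `i`-th axis with sign `s`. -/
lemma isWedge_coordinate {i : Fin 4} (hi : i ≠ 0) {s : ℝ} (hs : s * s = 1) (a : Spacetime) :
    IsWedge {z | |z 0 - a 0| < s * (z i - a i)} := by
  refine ⟨_, isPoincare_scaledSwap_add hi hs a, ?_⟩
  have hswap : Equiv.swap 1 i 0 = 0 := Equiv.swap_apply_of_ne_of_ne (by decide) hi.symm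
  have habs : |s| = 1 := by
    rcases mul_self_eq_one_iff.mp hs with rfl | rfl <;> simp
  have hmem (z : Spacetime) :
      scaledSwap i s z ∈ standardWedge ↔ |z 0| < s * z i := by
    simp [standardWedge, scaledSwap_apply, hswap, abs_mul, habs]
  ext z
  constructor
  · intro hz
    refine ⟨scaledSwap i s (z - a), (hmem _).mpr hz, ?_⟩
    simp [scaledSwap_involutive i hs _]
  · rintro ⟨w, hw, rfl⟩
    rw [← scaledSwap_involutive i hs w, hmem] at hw
    simpa using hw

lemma exists_sign_mul_lt_abs {d : Spacetime} (hd : d ≠ 0) :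
    ∃ i : Fin 4, i ≠ 0 ∧ ∃ s : ℝ, s * s = 1 ∧ s * d i < |d 0| := by
  have hsign (t : ℝ) : ∃ s : ℝ, s * s = 1 ∧ s * t = -|t| := by
    rcases le_total 0 t with ht | ht
    · exact ⟨-1, by norm_num, by rw [abs_of_nonneg ht]; ring⟩
    · exact ⟨1, by norm_num, by rw [abs_of_nonpos ht]; ring⟩
  obtain ⟨j, hj⟩ := Function.ne_iff.mp hd
  have hj' : 0 < |d j| := abs_pos.mpr hj
  by_cases h0 : j = 0
  · subst h0
    obtain ⟨s, hs, hst⟩ := hsign (d 1)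
    exact ⟨1, by decide, s, hs, by linarith [abs_nonneg (d 1)]⟩
  · obtain ⟨s, hs, hst⟩ := hsign (d j)
    exact ⟨j, h0, s, hs, by linarith [abs_nonneg (d 0)]⟩

lemma exists_isWedge_mem_notMem_closure {x y : Spacetime} (hxy : y ≠ x) :
    ∃ W : Set Spacetime, IsWedge W ∧ x ∈ W ∧ y ∉ closure W := by
  obtain ⟨i, hi, s, hs, hlt⟩ := exists_sign_mul_lt_abs (sub_ne_zero.mpr hxy)
  simp only [Pi.sub_apply] at hlt
  obtain ⟨ε, hε, hεlt⟩ : ∃ ε : ℝ, 0 < ε ∧ s * (y i - x i) + ε < |y 0 - x 0| :=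
    ⟨(|y 0 - x 0| - s * (y i - x i)) / 2, by linarith, by linarith⟩
  set a : Spacetime := x - Pi.single i (s * ε)
  have ha0 : a 0 = x 0 := by simp [a, hi.symm]
  have hai : a i = x i - s * ε := by simp [a]
  have hmul (t : ℝ) : s * (t - a i) = s * (t - x i) + ε := by
    rw [hai]
    linear_combination ε * hs
  refine ⟨_, isWedge_coordinate hi hs a, ?_, fun hy => ?_⟩
  · simpa [ha0, hmul] using hε
  · have hclosed : IsClosed {z : Spacetime | |z 0 - a 0| ≤ s * (z i - a i)} :=
      isClosed_le (by fun_prop) (by fun_prop)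
    have hle : |y 0 - a 0| ≤ s * (y i - a i) :=
      closure_minimal (Set.ofPred_subset_ofPred.mpr fun _ => le_of_lt) hclosed hy
    rw [ha0, hmul] at hle
    exact hle.not_gt hεlt

/-- The intersection of the closures of all wedges containing a point `x` is exactly `{x}`;
in particular, any `y ≠ x` is excluded from the closure of some wedge containing `x`. -/
theorem iInter_closure_wedges_eq_singleton (x : Spacetime) :
    (⋂ W ∈ {W : Set Spacetime | IsWedge W ∧ x ∈ W}, closure W) = {x} ∧
    (∀ y : Spacetime, y ≠ x →
      ∃ W : Set Spacetime, IsWedge W ∧ x ∈ W ∧ y ∉ closure W) := by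
  refine ⟨Set.Subset.antisymm (fun y hy => ?_) ?_, fun y => exists_isWedge_mem_notMem_closure⟩
  · by_contra hxy
    obtain ⟨W, hW, hxW, hyW⟩ := exists_isWedge_mem_notMem_closure hxy
    exact hyW (Set.mem_iInter₂.mp hy W ⟨hW, hxW⟩)
  · rintro _ rfl
    exact Set.mem_iInter₂.mpr fun W hW => subset_closure hW.2

end Minkowski
end
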